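/- (Theorem 3, stability of power-weighted silhouettes; per-matching form.) Let (p_i)_{i=1}^N and (p′_i)_{i=1}^N be two families of pairs p_i = (a_i, b_i), p′_i = (a′_i, b′_i) of real numbers with a_i < b_i and a′_i < b′_i (a bijective matching of two persistence diagrams), let r ≥ 1, set w_i = (b_i − a_i)^r and w′_i = (b′_i − a′_i)^r with Σ_i w_i > 0 and Σ_i w′_i > 0, let c = max over all i of max(b_i − a_i, b′_i − a′_i), and suppose there is L > 0 with (b_i − a_i)/(b_i − a_i)^r ≤ L and (b′_i − a′_i)/(b′_i − a′_i)^r ≤ L for all i. Let φ(t) = (Σ_i w_i Λ_{p_i}(t))/(Σ_i w_i) and φ′(t) = (Σ_i w′_i Λ_{p′_i}(t))/(Σ_i w′_i) be the corresponding power-weighted silhouettes. Then for all t ∈ ℝ, |φ(t) − φ′(t)| ≤ (1 + 2 L r c^{r−1}) Σ_i ‖p_i − p′_i‖∞. -/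

import Mathlib

/-- The tent function of a persistence pair `p = (a, b)`. -/
noncomputable def tent (a b t : ℝ) : ℝ := max 0 (min (t - a) (b - t))

theorem tent_nonneg (a b t : ℝ) : 0 ≤ tent a b t := le_max_left _ _

theorem tent_le (a b t : ℝ) (h : a < b) : tent a b t ≤ b - a := by
  unfold tent
  rcases le_total (t - a) (b - t) with h1 | h1
  · rw [min_eq_left h1]; exact max_le (by linarith) (by linarith)
  · rw [min_eq_right h1]; exact max_le (by linarith) (by linarith)

theorem tent_lip (a b a' b' t : ℝ) :
    |tent a b t - tent a' b' t| ≤ max |a - a'| |b - b'| := by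
  unfold tent
  have h1 := abs_max_sub_max_le_max 0 (min (t - a) (b - t)) 0 (min (t - a') (b' - t))
  have h2 := abs_min_sub_min_le_max (t - a) (b - t) (t - a') (b' - t)
  have e1 : |t - a - (t - a')| = |a - a'| := by
    rw [abs_sub_comm a a']; congr 1; ring
  have e2 : |b - t - (b' - t)| = |b - b'| := by congr 1; ring
  rw [e1, e2] at h2
  refine h1.trans (max_le ?_ h2)
  simp

theorem rpow_lip_aux (x y c r : ℝ) (hr : 1 ≤ r) (hy : 0 < y) (hyx : y ≤ x) (hxc : x ≤ c) :
    x ^ r - y ^ r ≤ r * c ^ (r - 1) * (x - y) := by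
  have hx : 0 < x := hy.trans_le hyx
  have hq : 0 < y / x := div_pos hy hx
  have hB := one_add_mul_self_le_rpow_one_add (s := y / x - 1) (by linarith) hr
  have e : (1 + (y / x - 1)) = y / x := by ring
  rw [e, Real.div_rpow hy.le hx.le] at hB
  have hxr : 0 < x ^ r := Real.rpow_pos_of_pos hx r
  rw [le_div_iff₀ hxr] at hB
  have e2 : x ^ r = x ^ (r - 1) * x := by
    rw [Real.rpow_sub_one hx.ne']; field_simp
  have e3 : (1 + r * (y / x - 1)) * x ^ r = x ^ r - r * x ^ (r - 1) * (x - y) := by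
    rw [e2]; field_simp; ring
  have hm : x ^ (r - 1) ≤ c ^ (r - 1) := Real.rpow_le_rpow hx.le hxc (by linarith)
  have : r * x ^ (r - 1) * (x - y) ≤ r * c ^ (r - 1) * (x - y) := by
    have : 0 ≤ x - y := by linarith
    gcongr
  linarith

theorem rpow_lip (x y c r : ℝ) (hr : 1 ≤ r) (hx : 0 < x) (hy : 0 < y) (hxc : x ≤ c)
    (hyc : y ≤ c) : |x ^ r - y ^ r| ≤ r * c ^ (r - 1) * |x - y| := by
  rcases le_total y x with h | h
  · rw [abs_of_nonneg (sub_nonneg.2 (Real.rpow_le_rpow hy.le h (by linarith))),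
      abs_of_nonneg (sub_nonneg.2 h)]
    exact rpow_lip_aux x y c r hr hy h hxc
  · rw [abs_sub_comm, abs_sub_comm x,
      abs_of_nonneg (sub_nonneg.2 (Real.rpow_le_rpow hx.le h (by linarith))),
      abs_of_nonneg (sub_nonneg.2 h)]
    exact rpow_lip_aux y x c r hr hx h hyc

/-- Abstract weighted-mean estimate, in the case where the second total is the smaller one. -/
theorem weighted_aux (N : ℕ) (w w' l l' d : Fin N → ℝ) (K L : ℝ)
    (hw : ∀ i, 0 ≤ w i) (hw' : ∀ i, 0 ≤ w' i) (hS' : 0 < ∑ i, w' i)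
    (hSS : ∑ i, w' i ≤ ∑ i, w i) (hL : 0 < L)
    (hl0 : ∀ i, 0 ≤ l' i) (hl : ∀ i, l' i ≤ L * w' i)
    (hd : ∀ i, |l i - l' i| ≤ d i) (hK : ∀ i, |w i - w' i| ≤ K * d i) :
    |(∑ i, w i * l i) / (∑ i, w i) - (∑ i, w' i * l' i) / (∑ i, w' i)| ≤
      (1 + L * K) * ∑ i, d i := by
  set W := ∑ i, w i with hW
  set W' := ∑ i, w' i with hW'
  have hWp : 0 < W := hS'.trans_le hSS
  set m := (∑ i, w' i * l' i) / W' with hm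
  have hlW : ∀ i, l' i ≤ L * W := fun i => by
    have h1 : w' i ≤ W' := Finset.single_le_sum (fun j _ => hw' j) (Finset.mem_univ i)
    exact (hl i).trans (mul_le_mul_of_nonneg_left (h1.trans hSS) hL.le)
  have hm0 : 0 ≤ m :=
    div_nonneg (Finset.sum_nonneg fun i _ => mul_nonneg (hw' i) (hl0 i)) hS'.le
  have hmW : m ≤ L * W := by
    rw [hm, div_le_iff₀ hS', hW', Finset.mul_sum]
    refine Finset.sum_le_sum fun i _ => ?_
    rw [mul_comm]
    exact mul_le_mul_of_nonneg_right (hlW i) (hw' i)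
  have hmm : m * W' = ∑ i, w' i * l' i := by rw [hm]; field_simp
  have key : (∑ i, w i * l i) / W - m =
      (∑ i, (w i * (l i - l' i) + (w i - w' i) * (l' i - m))) / W := by
    rw [eq_div_iff hWp.ne', sub_mul, div_mul_cancel₀ _ hWp.ne']
    have : ∀ i, w i * (l i - l' i) + (w i - w' i) * (l' i - m) =
      w i * l i - w' i * l' i - m * w i + m * w' i := fun i => by ring
    simp only [this, Finset.sum_add_distrib, Finset.sum_sub_distrib, ← Finset.mul_sum]
    rw [← hmm]; ring
  rw [key, abs_div, abs_of_pos hWp, div_le_iff₀ hWp, mul_right_comm, Finset.mul_sum]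
  refine (Finset.abs_sum_le_sum_abs _ _).trans (Finset.sum_le_sum fun i _ => ?_)
  have h1 : w i ≤ W := Finset.single_le_sum (fun j _ => hw j) (Finset.mem_univ i)
  have h2 : |l' i - m| ≤ L * W := by
    rw [abs_le]; constructor <;> linarith [hl0 i, hlW i]
  have hd0 : 0 ≤ d i := (abs_nonneg _).trans (hd i)
  calc _ ≤ |w i * (l i - l' i)| + |(w i - w' i) * (l' i - m)| := abs_add_le _ _
    _ = w i * |l i - l' i| + |w i - w' i| * |l' i - m| := by
        rw [abs_mul, abs_mul, abs_of_nonneg (hw i)]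
    _ ≤ W * d i + (K * d i) * (L * W) := by
        have h3 := mul_le_mul h1 (hd i) (abs_nonneg _) hWp.le
        have h4 := mul_le_mul (hK i) h2 (abs_nonneg _) ((abs_nonneg _).trans (hK i))
        linarith
    _ = _ := by ring

/-- Theorem 3 (stability of power-weighted silhouettes; per-matching form).
For two bijectively matched families of persistence pairs with power weights
`w_i = (b_i − a_i)^r`, `w'_i = (b'_i − a'_i)^r` of positive totals, `r ≥ 1`,
`c` the maximum over all `i` of `max(b_i − a_i, b'_i − a'_i)`, and ratio bound `L`,
the corresponding power-weighted silhouettes satisfy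
`|φ(t) − φ'(t)| ≤ (1 + 2 L r c^{r−1}) Σ_i ‖p_i − p'_i‖∞` for all `t`. -/
theorem silhouette_stability (N : ℕ) (a b a' b' : Fin N → ℝ)
    (hab : ∀ i, a i < b i) (hab' : ∀ i, a' i < b' i) (r : ℝ) (hr : 1 ≤ r)
    (hS : 0 < ∑ i, (b i - a i) ^ r) (hS' : 0 < ∑ i, (b' i - a' i) ^ r)
    (c : ℝ) (hc : c = ⨆ i, max (b i - a i) (b' i - a' i))
    (L : ℝ) (hLpos : 0 < L)
    (hL : ∀ i, (b i - a i) / (b i - a i) ^ r ≤ L)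
    (hL' : ∀ i, (b' i - a' i) / (b' i - a' i) ^ r ≤ L)
    (t : ℝ) :
    |(∑ i, (b i - a i) ^ r * tent (a i) (b i) t) / (∑ i, (b i - a i) ^ r) -
        (∑ i, (b' i - a' i) ^ r * tent (a' i) (b' i) t) / (∑ i, (b' i - a' i) ^ r)| ≤
      (1 + 2 * L * r * c ^ (r - 1)) * ∑ i, max |a i - a' i| |b i - b' i| := by
  have hp : ∀ i, 0 < b i - a i := fun i => sub_pos.2 (hab i)
  have hp' : ∀ i, 0 < b' i - a' i := fun i => sub_pos.2 (hab' i)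
  have hw : ∀ i, 0 < (b i - a i) ^ r := fun i => Real.rpow_pos_of_pos (hp i) r
  have hw' : ∀ i, 0 < (b' i - a' i) ^ r := fun i => Real.rpow_pos_of_pos (hp' i) r
  have hcm : ∀ i, max (b i - a i) (b' i - a' i) ≤ c := fun i => by
    rw [hc]
    exact le_ciSup (f := fun i => max (b i - a i) (b' i - a' i)) (Set.finite_range _).bddAbove i
  have hK : ∀ i, |(b i - a i) ^ r - (b' i - a' i) ^ r| ≤
      (2 * r * c ^ (r - 1)) * max |a i - a' i| |b i - b' i| := fun i => by
    have hxc := (le_max_left _ _).trans (hcm i)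
    have hyc := (le_max_right _ _).trans (hcm i)
    have h := rpow_lip _ _ c r hr (hp i) (hp' i) hxc hyc
    have hc0 : 0 ≤ c := (hp i).le.trans hxc
    have hq : 0 ≤ r * c ^ (r - 1) := mul_nonneg (by linarith) (Real.rpow_nonneg hc0 _)
    have h2 : |b i - a i - (b' i - a' i)| ≤ 2 * max |a i - a' i| |b i - b' i| := by
      have e : b i - a i - (b' i - a' i) = (b i - b' i) - (a i - a' i) := by ring
      rw [e]
      have := abs_sub (b i - b' i) (a i - a' i)
      linarith [le_max_left |a i - a' i| |b i - b' i|, le_max_right |a i - a' i| |b i - b' i|]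
    have := mul_le_mul_of_nonneg_left h2 hq
    linarith
  have hl : ∀ i, tent (a i) (b i) t ≤ L * (b i - a i) ^ r := fun i =>
    (tent_le _ _ t (hab i)).trans ((div_le_iff₀ (hw i)).1 (hL i))
  have hl' : ∀ i, tent (a' i) (b' i) t ≤ L * (b' i - a' i) ^ r := fun i =>
    (tent_le _ _ t (hab' i)).trans ((div_le_iff₀ (hw' i)).1 (hL' i))
  have eK : 1 + 2 * L * r * c ^ (r - 1) = 1 + L * (2 * r * c ^ (r - 1)) := by ring
  rw [eK]
  rcases le_total (∑ i, (b' i - a' i) ^ r) (∑ i, (b i - a i) ^ r) with h | h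
  · exact weighted_aux N _ _ (fun i => tent (a i) (b i) t) (fun i => tent (a' i) (b' i) t) _ _ L
      (fun i => (hw i).le) (fun i => (hw' i).le) hS' h hLpos
      (fun i => tent_nonneg _ _ _) hl' (fun i => tent_lip _ _ _ _ _) hK
  · rw [abs_sub_comm]
    refine weighted_aux N _ _ (fun i => tent (a' i) (b' i) t) (fun i => tent (a i) (b i) t) _ _ L
      (fun i => (hw' i).le) (fun i => (hw i).le) hS h hLpos
      (fun i => tent_nonneg _ _ _) hl (fun i => ?_) (fun i => ?_)
    · rw [abs_sub_comm]; exact tent_lip _ _ _ _ _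
    · rw [abs_sub_comm]; exact hK i
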